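/- arXiv:2406.07650 — 2 statements merged into one kernel-verified Lean document; each statement's English description precedes it below -/
import Mathlib

section
/- Let λ > 0, ρ ≥ 0, and q′ ∈ (1,∞). There is a constant C_{q′} depending only on q′ such that for every bounded interval γ ⊂ ℝ, ( ∫_γ e^{−ρ q′ x²} (|x| + λ)^{−q′} dx )^{1/q′} ≤ C_{q′} λ^{−1} ( min{ λ, |γ|, ρ^{−1/2} } )^{1/q′}, where |γ| denotes the length of γ (and ρ^{−1/2} is interpreted as +∞ when ρ = 0). -/
open MeasureTheory in
/-- A dominated interval integral is at most the full integral of the dominating function. -/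
lemma intervalIntegral_le_integral_of_le {f g : ℝ → ℝ} {a b : ℝ} (hab : a ≤ b)
    (hf : Continuous f) (hg : Integrable g) (hg0 : ∀ x, 0 ≤ g x) (hfg : ∀ x, f x ≤ g x) :
    ∫ x in a..b, f x ≤ ∫ x, g x := by
  refine (intervalIntegral.integral_mono hab (hf.intervalIntegrable a b)
    hg.intervalIntegrable hfg).trans ?_
  rw [intervalIntegral.integral_of_le hab]
  exact setIntegral_le_integral hg (Filter.Eventually.of_forall hg0)

open MeasureTheory in
/-- The three-way bound on the integral before taking the `q`-th root. -/
lemma integral_exp_mul_inv_rpow_le {q lam ρ a b : ℝ} (hq : 1 < q) (hlam : 0 < lam)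
    (hρ : 0 ≤ ρ) (hab : a ≤ b) :
    ∫ x in a..b, Real.exp (-ρ * q * x ^ 2) * ((|x| + lam) ^ q)⁻¹
      ≤ (1 + (∫ x : ℝ, (1 + ‖x‖) ^ (-q)) + √Real.pi) * (lam ^ q)⁻¹ *
        (min lam (if ρ = 0 then b - a else min (b - a) (ρ ^ (-(1 / 2 : ℝ))))) := by
  have hpos : ∀ x : ℝ, 0 < |x| + lam := fun x => by positivity
  have hcont : Continuous fun x : ℝ => Real.exp (-ρ * q * x ^ 2) * ((|x| + lam) ^ q)⁻¹ := by
    refine Continuous.mul (by fun_prop) (Continuous.inv₀ ?_ fun x => ?_)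
    · exact Continuous.rpow_const (by fun_prop) fun x => Or.inl (hpos x).ne'
    · exact (Real.rpow_pos_of_pos (hpos x) q).ne'
  have hexp : ∀ x : ℝ, Real.exp (-ρ * q * x ^ 2) ≤ 1 := fun x => by
    rw [Real.exp_le_one_iff]
    have : 0 ≤ ρ * q * x ^ 2 := by positivity
    linarith
  have hw : ∀ x : ℝ, ((|x| + lam) ^ q)⁻¹ ≤ (lam ^ q)⁻¹ := fun x => by
    gcongr
    linarith [abs_nonneg x]
  set J := ∫ x : ℝ, (1 + ‖x‖) ^ (-q)
  have hJ0 : 0 ≤ J := integral_nonneg fun x => by positivity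
  have hL : 0 < (lam ^ q)⁻¹ := by positivity
  have hlength : ∫ x in a..b, Real.exp (-ρ * q * x ^ 2) * ((|x| + lam) ^ q)⁻¹
      ≤ (lam ^ q)⁻¹ * (1 * (b - a)) := by
    have := intervalIntegral.integral_mono (μ := volume) (g := fun _ => (lam ^ q)⁻¹) hab
      (hcont.intervalIntegrable a b) intervalIntegrable_const fun x =>
        (mul_le_of_le_one_left (by have := hpos x; positivity) (hexp x)).trans (hw x)
    simpa [mul_comm] using this
  have hscale : ∫ x in a..b, Real.exp (-ρ * q * x ^ 2) * ((|x| + lam) ^ q)⁻¹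
      ≤ (lam ^ q)⁻¹ * (J * lam) := by
    have hint : Integrable fun x : ℝ => (1 + ‖x‖) ^ (-q) :=
      integrable_one_add_norm (by simpa using hq)
    have heq : ∀ x : ℝ, (lam ^ q)⁻¹ * (1 + ‖x / lam‖) ^ (-q) = ((|x| + lam) ^ q)⁻¹ := fun x => by
      rw [Real.rpow_neg (by positivity), ← mul_inv,
        ← Real.mul_rpow hlam.le (by positivity), Real.norm_eq_abs, abs_div, abs_of_pos hlam]
      congr 2
      field_simp
      ring
    refine (intervalIntegral_le_integral_of_le hab hcont
      ((hint.comp_div hlam.ne').const_mul (lam ^ q)⁻¹) (fun x => by positivity)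
      fun x => ?_).trans_eq ?_
    · rw [heq]
      exact mul_le_of_le_one_left (by have := hpos x; positivity) (hexp x)
    · rw [integral_const_mul, Measure.integral_comp_div (fun x : ℝ => (1 + ‖x‖) ^ (-q)),
        abs_of_pos hlam, smul_eq_mul, mul_comm lam]
  have hgauss : ρ ≠ 0 → ∫ x in a..b, Real.exp (-ρ * q * x ^ 2) * ((|x| + lam) ^ q)⁻¹
      ≤ (lam ^ q)⁻¹ * (√Real.pi * ρ ^ (-(1 / 2 : ℝ))) := fun h0 => by
    have hρ' : 0 < ρ := lt_of_le_of_ne hρ (Ne.symm h0)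
    refine (intervalIntegral_le_integral_of_le hab hcont
      ((integrable_exp_neg_mul_sq hρ').const_mul (lam ^ q)⁻¹) (fun x => by positivity)
      fun x => ?_).trans_eq ?_
    · rw [mul_comm]
      refine mul_le_mul (hw x) (Real.exp_le_exp.2 ?_) (Real.exp_pos _).le hL.le
      nlinarith [mul_nonneg hρ (sq_nonneg x)]
    · rw [integral_const_mul, integral_gaussian, Real.sqrt_div Real.pi_pos.le,
        Real.rpow_neg hρ, ← Real.sqrt_eq_rpow, div_eq_mul_inv]
  have hK : ∀ {c m : ℝ}, 0 ≤ m → c ≤ 1 + J + √Real.pi →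
      (lam ^ q)⁻¹ * (c * m) ≤ (1 + J + √Real.pi) * (lam ^ q)⁻¹ * m := fun {c m} hm hc => by
    calc (lam ^ q)⁻¹ * (c * m) = c * ((lam ^ q)⁻¹ * m) := by ring
      _ ≤ (1 + J + √Real.pi) * ((lam ^ q)⁻¹ * m) := by gcongr
      _ = _ := by ring
  have hpi := Real.sqrt_nonneg Real.pi
  have hab' : 0 ≤ b - a := sub_nonneg.2 hab
  have hA := hscale.trans (hK hlam.le (by linarith))
  have hB := hlength.trans (hK hab' (by linarith))
  split_ifs with h0
  · rcases min_choice lam (b - a) with h | h <;> rw [h] <;> assumption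
  · have hG := (hgauss h0).trans (hK (by positivity) (by linarith))
    rcases min_choice lam (min (b - a) (ρ ^ (-(1 / 2 : ℝ)))) with h | h <;> rw [h]
    · exact hA
    · rcases min_choice (b - a) (ρ ^ (-(1 / 2 : ℝ))) with h | h <;> rw [h] <;> assumption


/- STATEMENT 15: for λ > 0, ρ ≥ 0, q′ ∈ (1,∞) and any bounded interval γ = [a,b],
`‖e^{−ρx²}(|x|+λ)^{−1}‖_{L^{q′}(γ)} ≤ C_{q′} λ^{−1} (min{λ, |γ|, ρ^{−1/2}})^{1/q′}`,
where `ρ^{−1/2}` is interpreted as `+∞` when `ρ = 0`. -/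
theorem exp_weight_interval_bound (q' : ℝ) (hq' : 1 < q') :
    ∃ C > 0, ∀ lam ρ : ℝ, 0 < lam → 0 ≤ ρ → ∀ a b : ℝ, a ≤ b →
      (∫ x in a..b, Real.exp (-ρ * q' * x ^ 2) * ((|x| + lam) ^ q')⁻¹) ^ (1 / q')
        ≤ C * lam⁻¹ *
          (min lam (if ρ = 0 then b - a else min (b - a) (ρ ^ (-(1 / 2 : ℝ))))) ^ (1 / q') := by
  have hJ0 : 0 ≤ ∫ x : ℝ, (1 + ‖x‖) ^ (-q') :=
    MeasureTheory.integral_nonneg fun x => by positivity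
  have hK : 0 < 1 + (∫ x : ℝ, (1 + ‖x‖) ^ (-q')) + √Real.pi := by positivity
  refine ⟨(1 + (∫ x : ℝ, (1 + ‖x‖) ^ (-q')) + √Real.pi) ^ (1 / q'),
    Real.rpow_pos_of_pos hK _, fun lam ρ hlam hρ a b hab => ?_⟩
  have hq0 : 0 < q' := by linarith
  have hm : 0 ≤ min lam (if ρ = 0 then b - a else min (b - a) (ρ ^ (-(1 / 2 : ℝ)))) := by
    have hab' : 0 ≤ b - a := sub_nonneg.2 hab
    split_ifs <;> positivity
  have hI : 0 ≤ ∫ x in a..b, Real.exp (-ρ * q' * x ^ 2) * ((|x| + lam) ^ q')⁻¹ :=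
    intervalIntegral.integral_nonneg hab fun x _ => by positivity
  refine (Real.rpow_le_rpow hI (integral_exp_mul_inv_rpow_le hq' hlam hρ hab)
    (by positivity)).trans_eq ?_
  rw [Real.mul_rpow (by positivity) hm, Real.mul_rpow hK.le (by positivity),
    Real.inv_rpow (by positivity), one_div, Real.rpow_rpow_inv hlam.le hq0.ne']
end

section
/- There is a universal constant C > 0 with the following property. Let μ be a finite positive Borel measure on ℝ, not identically zero, with faster-than-exponential decay: lim_{T→∞} (1/T) log μ{ x : |x| > T } = −∞. For k ∈ ℝ define the measure μ_k by dμ_k(x) = e^{kx} dμ(x) (each μ_k is finite by the decay assumption). Then for every N ∈ ℝ⁺ there exist finitely or countably many pairwise disjoint intervals I_j ⊂ ℝ and numbers k_j ∈ [N, 2N] such that (i) μ_{k_j}(I_j) ≥ (1/2) μ_{k_j}(ℝ) for every j, and (ii) Σ_j |I_j|^{−1} ≥ C N, where |I_j| is the length of I_j. -/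
open MeasureTheory Filter
open scoped ENNReal

open ProbabilityTheory

/-- Faster-than-exponential decay makes all exponentials integrable. -/
lemma integrableExpSet_eq_univ_of_decay {μ : Measure ℝ} [IsFiniteMeasure μ]
    (h : ∀ M > 0, ∀ᶠ T in atTop, μ {x : ℝ | T < |x|} ≤ ENNReal.ofReal (Real.exp (-M * T))) :
    integrableExpSet id μ = Set.univ := by
  refine Set.eq_univ_of_forall fun k ↦ ?_
  have hmeas : Measurable fun x : ℝ ↦ Real.exp (k * x) := by fun_prop
  refine ⟨hmeas.aestronglyMeasurable, ?_⟩
  rw [hasFiniteIntegral_iff_ofReal (ae_of_all _ fun x ↦ (Real.exp_pos _).le)]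
  obtain ⟨T₀, hT₀⟩ := eventually_atTop.1 (h (|k| + 1) (by positivity))
  obtain ⟨n₀, hn₀⟩ := exists_nat_ge T₀
  set A : ℕ → Set ℝ := fun n ↦ {x | ((n + n₀ : ℕ) : ℝ) < |x| ∧ |x| ≤ (n + n₀ : ℕ) + 1} with hA
  have hcover : Set.univ ⊆ {x : ℝ | |x| ≤ n₀} ∪ ⋃ n, A n := by
    intro x _
    rcases le_or_gt |x| n₀ with hx | hx
    · exact Or.inl hx
    · refine Or.inr (Set.mem_iUnion.2 ⟨⌈|x|⌉₊ - 1 - n₀, ?_⟩)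
      have h1 : n₀ < ⌈|x|⌉₊ := Nat.lt_ceil.2 hx
      have h2 : ⌈|x|⌉₊ - 1 - n₀ + n₀ = ⌈|x|⌉₊ - 1 := by omega
      have h3 : ((⌈|x|⌉₊ - 1 : ℕ) : ℝ) + 1 = ⌈|x|⌉₊ := by
        exact_mod_cast Nat.sub_add_cancel (by omega)
      simp only [hA, Set.mem_ofPred_eq, h2]
      exact ⟨Nat.lt_ceil.1 (by omega), h3 ▸ Nat.le_ceil _⟩
  have hexp {x r : ℝ} (hx : |x| ≤ r) :
      ENNReal.ofReal (Real.exp (k * x)) ≤ ENNReal.ofReal (Real.exp (|k| * r)) := by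
    refine ENNReal.ofReal_le_ofReal (Real.exp_le_exp.2 ((le_abs_self _).trans ?_))
    rw [abs_mul]
    gcongr
  have hterm (n : ℕ) : ∫⁻ x in A n, ENNReal.ofReal (Real.exp (k * x)) ∂μ
      ≤ ENNReal.ofReal (Real.exp |k| * Real.exp (-1) ^ n) := by
    calc ∫⁻ x in A n, ENNReal.ofReal (Real.exp (k * x)) ∂μ
        ≤ ∫⁻ _ in A n, ENNReal.ofReal (Real.exp (|k| * ((n + n₀ : ℕ) + 1))) ∂μ :=
          setLIntegral_mono measurable_const fun x hx ↦ hexp hx.2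
      _ ≤ ENNReal.ofReal (Real.exp (|k| * ((n + n₀ : ℕ) + 1)))
            * ENNReal.ofReal (Real.exp (-(|k| + 1) * (n + n₀ : ℕ))) := by
          rw [setLIntegral_const]
          gcongr
          refine (measure_mono fun x hx ↦ hx.1).trans (hT₀ _ (hn₀.trans ?_))
          exact_mod_cast Nat.le_add_left _ _
      _ ≤ ENNReal.ofReal (Real.exp |k| * Real.exp (-1) ^ n) := by
          rw [← ENNReal.ofReal_mul (Real.exp_pos _).le, ← Real.exp_add, ← Real.exp_nat_mul,
            ← Real.exp_add]
          refine ENNReal.ofReal_le_ofReal (Real.exp_le_exp.2 ?_)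
          push_cast
          nlinarith [(Nat.cast_nonneg n₀ : (0 : ℝ) ≤ n₀)]
  have hsum : Summable fun n : ℕ ↦ Real.exp |k| * Real.exp (-1) ^ n :=
    (summable_geometric_of_lt_one (Real.exp_pos _).le (by simp)).mul_left _
  calc ∫⁻ x, ENNReal.ofReal (Real.exp (k * x)) ∂μ
      ≤ ∫⁻ x in {x : ℝ | |x| ≤ n₀} ∪ ⋃ n, A n, ENNReal.ofReal (Real.exp (k * x)) ∂μ := by
        rw [← setLIntegral_univ]
        exact lintegral_mono_set hcover
    _ ≤ ∫⁻ x in {x : ℝ | |x| ≤ n₀}, ENNReal.ofReal (Real.exp (k * x)) ∂μ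
          + ∑' n, ∫⁻ x in A n, ENNReal.ofReal (Real.exp (k * x)) ∂μ :=
        (lintegral_union_le _ _ _).trans (by gcongr; exact lintegral_iUnion_le _ _)
    _ ≤ ENNReal.ofReal (Real.exp (|k| * n₀)) * μ {x : ℝ | |x| ≤ n₀}
          + ∑' n, ENNReal.ofReal (Real.exp |k| * Real.exp (-1) ^ n) := by
        rw [← setLIntegral_const]
        exact add_le_add (setLIntegral_mono measurable_const fun x hx ↦ hexp hx)
          (ENNReal.tsum_le_tsum hterm)
    _ < ∞ := by
        refine ENNReal.add_lt_top.2
          ⟨ENNReal.mul_lt_top ENNReal.ofReal_lt_top (measure_lt_top _ _), ?_⟩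
        rw [← ENNReal.ofReal_tsum_of_nonneg (fun n ↦ by positivity) hsum]
        exact ENNReal.ofReal_lt_top

/-- If `m' = s ^ 2`, then the parameters `k` at which `m k` lies within `2 (s k + σ)` of `m₀` while
`s k` is not much smaller than `σ` form a set of measure `O(1 / σ)`. -/
lemma volume_setOf_abs_sub_le_of_hasDerivAt_sq {m s : ℝ → ℝ}
    (hm : ∀ k, HasDerivAt m (s k ^ 2) k) (m₀ p q : ℝ) (hpq : p ≤ q) {σ : ℝ} (hσ : 0 < σ) :
    volume {k ∈ Set.Icc p q | |m k - m₀| ≤ 2 * (s k + σ) ∧ σ ≤ 2 * s k}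
      ≤ ENNReal.ofReal (40 * Real.pi / σ) := by
  set g : ℝ → ℝ := fun k ↦ Real.arctan ((m k - m₀) / σ)
  set g' : ℝ → ℝ := fun k ↦ 1 / (1 + ((m k - m₀) / σ) ^ 2) * (s k ^ 2 / σ)
  have hg (k : ℝ) : HasDerivAt g (g' k) k := (((hm k).sub_const m₀).div_const σ).arctan
  have hg'0 (k : ℝ) : 0 ≤ g' k := by positivity
  have hcont : ContinuousOn g (Set.Icc p q) := fun k _ ↦ (hg k).continuousAt.continuousWithinAt
  have hint : IntegrableOn g' (Set.Ioc p q) :=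
    intervalIntegral.integrableOn_deriv_of_nonneg hcont (fun k _ ↦ hg k) fun k _ ↦ hg'0 k
  have hftc : ∫ k in Set.Ioc p q, g' k = g q - g p := by
    rw [← intervalIntegral.integral_of_le hpq]
    exact intervalIntegral.integral_eq_sub_of_hasDerivAt (fun k _ ↦ hg k)
      ((intervalIntegrable_iff_integrableOn_Ioc_of_le hpq).2 hint)
  have hbound : g q - g p ≤ Real.pi := by
    have h1 := Real.arctan_lt_pi_div_two ((m q - m₀) / σ)
    have h2 := Real.neg_pi_div_two_lt_arctan ((m p - m₀) / σ)
    simp only [g]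
    linarith
  have hlower {k : ℝ} (h1 : |m k - m₀| ≤ 2 * (s k + σ)) (h2 : σ ≤ 2 * s k) :
      1 ≤ 40 / σ * g' k := by
    have h3 : (m k - m₀) ^ 2 ≤ (6 * s k) ^ 2 :=
      sq_le_sq.2 ((h1.trans (by linarith)).trans (le_abs_self _))
    have h4 : 40 / σ * g' k = 40 * s k ^ 2 / (σ ^ 2 + (m k - m₀) ^ 2) := by
      simp only [g']
      field_simp
    rw [h4, one_le_div (by positivity)]
    nlinarith
  have hIoc : volume.restrict (Set.Icc p q) = volume.restrict (Set.Ioc p q) :=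
    Measure.restrict_congr_set Ioc_ae_eq_Icc.symm
  calc volume {k ∈ Set.Icc p q | |m k - m₀| ≤ 2 * (s k + σ) ∧ σ ≤ 2 * s k}
      ≤ (volume.restrict (Set.Icc p q)) {k | |m k - m₀| ≤ 2 * (s k + σ) ∧ σ ≤ 2 * s k} := by
        rw [Measure.restrict_apply' measurableSet_Icc, Set.inter_comm]
        rfl
    _ ≤ ∫⁻ k in Set.Ioc p q, ENNReal.ofReal (40 / σ * g' k) := by
        rw [hIoc]
        refine meas_le_lintegral₀ (hint.aemeasurable.const_mul _).ennreal_ofReal fun k hk ↦ ?_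
        exact ENNReal.one_le_ofReal.2 (hlower hk.1 hk.2)
    _ = ENNReal.ofReal (40 / σ * (g q - g p)) := by
        rw [← ofReal_integral_eq_lintegral_ofReal (hint.const_mul _)
          (ae_of_all _ fun k ↦ mul_nonneg (by positivity) (hg'0 k)), integral_const_mul, hftc]
    _ ≤ ENNReal.ofReal (40 * Real.pi / σ) := by
        refine ENNReal.ofReal_le_ofReal ?_
        rw [div_mul_eq_mul_div]
        gcongr

/-- If `m' = s ^ 2` and `s` is bounded below on `[N, 2 N]`, one can select countably many pairwise
disjoint intervals `[m k - 2 s k, m k + 2 s k]` whose inverse lengths add up to a multiple of `N`. -/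
lemma exists_pairwiseDisjoint_closedBall_of_hasDerivAt_sq {m s : ℝ → ℝ}
    (hm : ∀ k, HasDerivAt m (s k ^ 2) k) {N c : ℝ} (hN : 0 < N) (hc : 0 < c)
    (hs : ∀ k ∈ Set.Icc N (2 * N), c ≤ s k) :
    ∃ u ⊆ Set.Icc N (2 * N), u.Countable ∧
      u.PairwiseDisjoint (fun k ↦ Metric.closedBall (m k) (2 * s k)) ∧
      ENNReal.ofReal N ≤ ∑' k : u, ENNReal.ofReal (40 * Real.pi / s k) := by
  have hpos {k : ℝ} (hk : k ∈ Set.Icc N (2 * N)) : 0 < s k := hc.trans_le (hs k hk)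
  obtain ⟨u, huN, hdisj, hu⟩ := Vitali.exists_disjoint_subfamily_covering_enlargement
    (fun k ↦ Metric.closedBall (m k) (2 * s k)) (Set.Icc N (2 * N)) (fun k ↦ (s k)⁻¹) 2 one_lt_two
    (fun k hk ↦ inv_nonneg.2 (hpos hk).le) c⁻¹ (fun k hk ↦ inv_anti₀ hc (hs k hk))
    (fun k hk ↦ Metric.nonempty_closedBall.2 (by linarith [hpos hk]))
  have hcount : u.Countable := hdisj.countable_of_nonempty_interior fun k hk ↦
    ⟨m k, Metric.ball_subset_interior_closedBall
      (Metric.mem_ball_self (by linarith [hpos (huN hk)]))⟩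
  refine ⟨u, huN, hcount, hdisj, ?_⟩
  have hcover : Set.Icc N (2 * N) ⊆ ⋃ b ∈ u,
      {k ∈ Set.Icc N (2 * N) | |m k - m b| ≤ 2 * (s k + s b) ∧ s b ≤ 2 * s k} := by
    intro k hk
    obtain ⟨b, hb, hinter, hle⟩ := hu k hk
    refine Set.mem_biUnion hb ⟨hk, ?_, ?_⟩
    · rw [← Real.dist_eq, mul_add]
      exact Metric.dist_le_add_of_nonempty_closedBall_inter_closedBall hinter
    · have h1 := hpos hk
      have h2 := hpos (huN hb)
      simp only [inv_eq_one_div] at hle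
      field_simp at hle
      linarith
  calc ENNReal.ofReal N = volume (Set.Icc N (2 * N)) := by
        rw [Real.volume_Icc]
        ring_nf
    _ ≤ ∑' b : u, volume
          {k ∈ Set.Icc N (2 * N) | |m k - m b| ≤ 2 * (s k + s b) ∧ s b ≤ 2 * s k} :=
        (measure_mono hcover).trans (measure_biUnion_le _ hcount _)
    _ ≤ ∑' k : u, ENNReal.ofReal (40 * Real.pi / s k) :=
        ENNReal.tsum_le_tsum fun b ↦ volume_setOf_abs_sub_le_of_hasDerivAt_sq hm (m b) N (2 * N)
          (by linarith) (hpos (huN b.2))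

/-- Chebyshev's inequality: half of the mass lies within two standard deviations of the mean. -/
lemma half_le_measure_Icc_of_two_mul_sqrt_variance_le {ν : Measure ℝ} [IsProbabilityMeasure ν]
    (hν : MemLp id 2 ν) {r : ℝ} (hr : 0 < r) (hσ : 2 * √(Var[id; ν]) ≤ r) :
    1 / 2 ≤ ν (Set.Icc (ν[id] - r) (ν[id] + r)) := by
  have hvar : Var[id; ν] / r ^ 2 ≤ 1 / 2 := by
    rw [div_le_iff₀ (by positivity)]
    nlinarith [Real.sq_sqrt (variance_nonneg id ν), Real.sqrt_nonneg (Var[id; ν])]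
  have hcompl : ν (Set.Icc (ν[id] - r) (ν[id] + r))ᶜ ≤ 1 / 2 := by
    calc ν (Set.Icc (ν[id] - r) (ν[id] + r))ᶜ ≤ ν {x | r ≤ |id x - ν[id]|} := by
          refine measure_mono fun x hx ↦ ?_
          simp only [Set.mem_ofPred_eq]
          contrapose! hx
          rw [Set.notMem_compl_iff]
          have := abs_lt.1 hx
          simp only [id] at this ⊢
          exact ⟨by linarith, by linarith⟩
      _ ≤ ENNReal.ofReal (Var[id; ν] / r ^ 2) := meas_ge_le_variance_div_sq hν hr
      _ ≤ ENNReal.ofReal (1 / 2) := ENNReal.ofReal_le_ofReal hvar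
      _ = 1 / 2 := by simp
  rw [prob_compl_eq_one_sub measurableSet_Icc] at hcompl
  have h1 : (1 / 2 + 1 / 2 : ℝ≥0∞) ≤ 1 / 2 + ν (Set.Icc (ν[id] - r) (ν[id] + r)) := by
    rw [ENNReal.add_halves]
    exact tsub_le_iff_right.1 hcompl
  exact (ENNReal.add_le_add_iff_left (by simp)).1 h1

/-- The tilted measure of a set compares the mass of that set to the total mass. -/
lemma mul_lintegral_exp_le_of_le_tilted {α : Type*} [MeasurableSpace α] {μ : Measure α} [NeZero μ]
    {f : α → ℝ} (hf : Integrable (fun x ↦ Real.exp (f x)) μ) {S : Set α} (hS : MeasurableSet S)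
    {c : ℝ≥0∞} (h : c ≤ μ.tilted f S) :
    c * ∫⁻ x, ENNReal.ofReal (Real.exp (f x)) ∂μ
      ≤ ∫⁻ x in S, ENNReal.ofReal (Real.exp (f x)) ∂μ := by
  have hpos : 0 < ∫ x, Real.exp (f x) ∂μ := integral_exp_pos hf
  rw [tilted_apply' _ _ hS] at h
  simp_rw [ENNReal.ofReal_div_of_pos hpos, div_eq_mul_inv] at h
  rw [lintegral_mul_const' _ _ (by simpa using hpos), ← div_eq_mul_inv] at h
  rw [← ofReal_integral_eq_lintegral_ofReal hf (ae_of_all _ fun _ ↦ (Real.exp_pos _).le)]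
  exact (ENNReal.le_div_iff_mul_le (Or.inl (by simpa using hpos)) (Or.inl (by simp))).1 h

/- STATEMENT 18: Wolff's lemma on measures with faster-than-exponential decay:
there is a universal constant C > 0 such that for every finite nonzero positive measure μ on ℝ
with lim_{T→∞} (1/T) log μ{|x| > T} = −∞ (equivalently: for every M > 0 one eventually has
μ{|x| > T} ≤ e^{−MT}), and every N > 0, there are pairwise disjoint intervals I_j = [a_j, b_j]
and numbers k_j ∈ [N, 2N] with μ_{k_j}(I_j) ≥ (1/2)‖μ_{k_j}‖ and ∑_j |I_j|⁻¹ ≥ C N,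
where dμ_k(x) = e^{kx} dμ(x). -/
theorem wolff_measure_lemma :
    ∃ C > 0, ∀ μ : Measure ℝ, IsFiniteMeasure μ → μ ≠ 0 →
      (∀ M > 0, ∀ᶠ T in atTop, μ {x : ℝ | T < |x|} ≤ ENNReal.ofReal (Real.exp (-M * T))) →
      ∀ N : ℝ, 0 < N →
        ∃ (J : Set ℕ) (k : ℕ → ℝ) (a b : ℕ → ℝ),
          (∀ j ∈ J, k j ∈ Set.Icc N (2 * N)) ∧
          (∀ j ∈ J, a j < b j) ∧
          (∀ i ∈ J, ∀ j ∈ J, i ≠ j → Disjoint (Set.Icc (a i) (b i)) (Set.Icc (a j) (b j))) ∧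
          (∀ j ∈ J, (1 / 2 : ℝ≥0∞) * ∫⁻ x, ENNReal.ofReal (Real.exp (k j * x)) ∂μ
              ≤ ∫⁻ x in Set.Icc (a j) (b j), ENNReal.ofReal (Real.exp (k j * x)) ∂μ) ∧
          ENNReal.ofReal (C * N) ≤ ∑' j : J, ENNReal.ofReal ((b (j : ℕ) - a (j : ℕ))⁻¹) := by
  refine ⟨1 / (160 * Real.pi), by positivity, fun μ _ hμ hdecay N hN ↦ ?_⟩
  have : NeZero μ := ⟨hμ⟩
  have huniv := integrableExpSet_eq_univ_of_decay hdecay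
  have hint (k : ℝ) : Integrable (fun x ↦ Real.exp (k * x)) μ := by
    have : k ∈ integrableExpSet id μ := huniv ▸ Set.mem_univ k
    exact this
  have hmem (k : ℝ) : k ∈ interior (integrableExpSet id μ) := by simp [huniv]
  set m : ℝ → ℝ := deriv (cgf id μ)
  set s : ℝ → ℝ := fun k ↦ √(iteratedDeriv 2 (cgf id μ) k)
  have hvar (k : ℝ) : Var[id; μ.tilted (k * ·)] = iteratedDeriv 2 (cgf id μ) k :=
    variance_tilted_mul (hmem k)
  have hmean (k : ℝ) : (μ.tilted (k * ·))[id] = m k := integral_tilted_mul_self (hmem k)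
  have hm (k : ℝ) : HasDerivAt m (s k ^ 2) k := by
    rw [Real.sq_sqrt (hvar k ▸ variance_nonneg _ _), iteratedDeriv_succ, iteratedDeriv_one]
    exact (analyticAt_cgf (hmem k)).deriv.differentiableAt.hasDerivAt
  have hmass {k r : ℝ} (hr : 0 < r) (hsr : 2 * s k ≤ r) :
      (1 / 2 : ℝ≥0∞) * ∫⁻ x, ENNReal.ofReal (Real.exp (k * x)) ∂μ
        ≤ ∫⁻ x in Set.Icc (m k - r) (m k + r), ENNReal.ofReal (Real.exp (k * x)) ∂μ := by
    have : IsProbabilityMeasure (μ.tilted (k * ·)) := isProbabilityMeasure_tilted (hint k)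
    refine mul_lintegral_exp_le_of_le_tilted (hint k) measurableSet_Icc ?_
    rw [← hmean k]
    refine half_le_measure_Icc_of_two_mul_sqrt_variance_le
      (ν := μ.tilted (k * ·)) (memLp_tilted_mul (hmem k) 2) hr ?_
    rwa [hvar k]
  by_cases hsmall : ∃ k ∈ Set.Icc N (2 * N), s k < 1 / N
  · obtain ⟨k, hk, hsk⟩ := hsmall
    refine ⟨{0}, fun _ ↦ k, fun _ ↦ m k - 2 / N, fun _ ↦ m k + 2 / N, fun _ _ ↦ hk,
      fun _ _ ↦ by linarith [show (0 : ℝ) < 2 / N by positivity], ?_, fun _ _ ↦ ?_, ?_⟩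
    · rintro i rfl j rfl hij
      exact absurd rfl hij
    · refine hmass (by positivity) ?_
      calc 2 * s k ≤ 2 * (1 / N) := by gcongr
        _ = 2 / N := by ring
    · rw [tsum_singleton 0 fun _ ↦ ENNReal.ofReal ((m k + 2 / N - (m k - 2 / N))⁻¹)]
      refine ENNReal.ofReal_le_ofReal ?_
      have h1 : (m k + 2 / N - (m k - 2 / N))⁻¹ = 1 / 4 * N := by
        rw [show m k + 2 / N - (m k - 2 / N) = 4 / N by ring, inv_div]
        ring
      rw [h1]
      gcongr
      linarith [Real.pi_gt_three]
  · push Not at hsmall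
    obtain ⟨u, huN, hcount, hdisj, hsum⟩ :=
      exists_pairwiseDisjoint_closedBall_of_hasDerivAt_sq hm hN (by positivity) hsmall
    have hpos {k : ℝ} (hk : k ∈ u) : 0 < s k :=
      lt_of_lt_of_le (by positivity) (hsmall k (huN hk))
    have : Nonempty u := by
      by_contra! hempty
      simp only [tsum_empty, nonpos_iff_eq_zero, ENNReal.ofReal_eq_zero] at hsum
      linarith
    have : Countable u := hcount
    obtain ⟨e, he⟩ := exists_injective_nat u
    set κ : ℕ → u := Function.invFun e
    have hκ (k : u) : κ (e k) = k := Function.leftInverse_invFun he k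
    refine ⟨Set.range e, fun j ↦ κ j, fun j ↦ m (κ j) - 2 * s (κ j),
      fun j ↦ m (κ j) + 2 * s (κ j), fun j _ ↦ huN (κ j).2,
      fun j _ ↦ by linarith [hpos (κ j).2], ?_, fun j _ ↦ ?_, ?_⟩
    · rintro _ ⟨i, rfl⟩ _ ⟨j, rfl⟩ hij
      simp only [hκ, ← Real.closedBall_eq_Icc]
      exact hdisj i.2 j.2 fun h ↦ hij (congrArg e (Subtype.ext h))
    · exact hmass (by linarith [hpos (κ j).2]) le_rfl
    · rw [← (Equiv.ofInjective e he).tsum_eq]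
      simp only [Equiv.ofInjective_apply, hκ]
      calc ENNReal.ofReal (1 / (160 * Real.pi) * N)
          = ENNReal.ofReal (1 / (160 * Real.pi)) * ENNReal.ofReal N :=
            ENNReal.ofReal_mul (by positivity)
        _ ≤ ENNReal.ofReal (1 / (160 * Real.pi))
              * ∑' k : u, ENNReal.ofReal (40 * Real.pi / s k) := by gcongr
        _ = ∑' k : u, ENNReal.ofReal ((m k + 2 * s k - (m k - 2 * s k))⁻¹) := by
            rw [← ENNReal.tsum_mul_left]
            refine tsum_congr fun k ↦ ?_
            rw [← ENNReal.ofReal_mul (by positivity)]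
            congr 1
            have := hpos k.2
            rw [show m k + 2 * s k - (m k - 2 * s k) = 4 * s k by ring]
            field_simp
            norm_num
end
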